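/- If A_1, …, A_n are positive semidefinite real symmetric n×n matrices, then the mixed determinant satisfies (∏_{j=1}^n det A_j)^{1/n} ≤ D_n(A_1,…,A_n). -/

import Mathlib

open Matrix BigOperators

noncomputable def sgn (b : Bool) : ℝ := if b then 1 else -1

/-- The mixed determinant: the full symmetric multilinear polarization of the
determinant. -/
noncomputable def mixedDet {ι : Type*} [Fintype ι] [DecidableEq ι]
    (M : ι → Matrix ι ι ℝ) : ℝ :=
  (1 / (2 ^ Fintype.card ι * (Fintype.card ι).factorial)) *
    ∑ ε : ι → Bool, (∏ i, sgn (ε i)) * (∑ i, sgn (ε i) • M i).det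

/-- AM-GM with equal weights. -/
theorem grh_amgm {n : ℕ} (z : Fin (n + 1) → ℝ) (hz : ∀ k, 0 ≤ z k) :
    (∏ k, z k) ^ ((1 : ℝ) / ((n + 1 : ℕ) : ℝ)) ≤ (1 / ((n + 1 : ℕ) : ℝ)) * ∑ k, z k := by
  have hn : (0 : ℝ) < ((n + 1 : ℕ) : ℝ) := by positivity
  have h := Real.geom_mean_le_arith_mean_weighted Finset.univ
    (fun _ : Fin (n + 1) => (1 : ℝ) / ((n + 1 : ℕ) : ℝ)) z
    (fun _ _ => by positivity)
    (by
      rw [Finset.sum_const, Finset.card_univ, Fintype.card_fin, nsmul_eq_mul]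
      field_simp)
    (fun k _ => hz k)
  rw [Real.finsetProd_rpow _ _ (fun k _ => hz k), ← Finset.mul_sum] at h
  exact h

theorem grh_det_le_one {n : ℕ} (C : Matrix (Fin (n + 1)) (Fin (n + 1)) ℝ) (hC : C.PosSemidef)
    (hd : ∀ k, C k k = 1) : C.det ≤ 1 := by
  have h := grh_amgm (fun k => hC.1.eigenvalues k) (fun k => hC.eigenvalues_nonneg k)
  have htr := hC.1.trace_eq_sum_eigenvalues
  have hdet := hC.1.det_eq_prod_eigenvalues
  simp only [RCLike.ofReal_real_eq_id, id] at htr hdet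
  rw [← hdet, ← htr] at h
  have : C.trace = ((n + 1 : ℕ) : ℝ) := by
    simp [Matrix.trace, hd]
  rw [this] at h
  have hn : (0 : ℝ) < ((n + 1 : ℕ) : ℝ) := by positivity
  rw [one_div_mul_cancel hn.ne'] at h
  by_contra hlt
  push Not at hlt
  have := Real.one_lt_rpow hlt (z := (1 : ℝ) / ((n + 1 : ℕ) : ℝ)) (by positivity)
  linarith

/-- Hadamard's inequality. -/
theorem grh_hadamard {n : ℕ} (B : Matrix (Fin (n + 1)) (Fin (n + 1)) ℝ) (hB : B.PosDef) :
    B.det ≤ ∏ k, B k k := by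
  have hpos : ∀ k, 0 < B k k := fun k => hB.diag_pos
  set d : Fin (n + 1) → ℝ := fun k => (Real.sqrt (B k k))⁻¹ with hd
  have hC := hB.posSemidef.mul_mul_conjTranspose_same (Matrix.diagonal d)
  have h1 := grh_det_le_one _ hC (by
    intro k
    simp only [Matrix.diagonal_conjTranspose, Matrix.mul_diagonal, Matrix.diagonal_mul]
    have := Real.mul_self_sqrt (hpos k).le
    have h2 := Real.sqrt_pos.2 (hpos k)
    simp only [hd, Pi.star_apply, star_trivial]
    field_simp
    nlinarith)
  rw [Matrix.det_mul, Matrix.det_mul, Matrix.diagonal_conjTranspose, Matrix.det_diagonal,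
    Matrix.det_diagonal] at h1
  have h3 : (∏ k, B k k) * ((∏ k, d k) * ∏ k, d k) = 1 := by
    rw [← Finset.prod_mul_distrib, ← Finset.prod_mul_distrib]
    apply Finset.prod_eq_one
    intro k _
    have := Real.mul_self_sqrt (hpos k).le
    have h2 := Real.sqrt_pos.2 (hpos k)
    simp only [hd]
    field_simp
    nlinarith
  have hP : 0 < ∏ k, B k k := Finset.prod_pos (fun k _ => hpos k)
  simp only [star_trivial] at h1
  calc B.det = (∏ k, B k k) * ((∏ k, d k) * B.det * ∏ k, d k) := by
        linear_combination (-B.det) * h3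
    _ ≤ (∏ k, B k k) * 1 := mul_le_mul_of_nonneg_left h1 hP.le
    _ = _ := mul_one _

/-- Product of principal minors. -/
theorem grh_minors {n : ℕ} (A : Matrix (Fin (n + 1)) (Fin (n + 1)) ℝ) (hA : A.PosDef) :
    A.det ^ n ≤ ∏ k : Fin (n + 1), (A.submatrix k.succAbove k.succAbove).det := by
  have hdet := hA.det_pos
  have h1 : ∀ k : Fin (n + 1), (A.submatrix k.succAbove k.succAbove).det = A.det * A⁻¹ k k := by
    intro k
    have h := Matrix.adjugate_fin_succ_eq_det_submatrix A k k
    rw [← two_mul, pow_mul] at h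
    simp only [even_two, Even.neg_pow, one_pow, one_mul] at h
    rw [← h, Matrix.inv_def, Matrix.smul_apply, Ring.inverse_eq_inv', smul_eq_mul]
    field_simp
  have h2 := grh_hadamard _ hA.inv
  rw [Matrix.det_nonsing_inv, Ring.inverse_eq_inv'] at h2
  simp_rw [h1, Finset.prod_mul_distrib]
  simp only [Finset.prod_const, Finset.card_univ, Fintype.card_fin]
  calc A.det ^ n = A.det ^ (n + 1) * A.det⁻¹ := by
        rw [pow_succ, mul_assoc, mul_inv_cancel₀ hdet.ne', mul_one]
    _ ≤ _ := mul_le_mul_of_nonneg_left h2 (by positivity)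

theorem grh_sign_sum {n : ℕ} (f : Fin n → Fin n) :
    ∑ ε : Fin n → Bool, (∏ i, sgn (ε i)) * ∏ i, sgn (ε (f i)) =
      if Function.Bijective f then (2 : ℝ) ^ n else 0 := by
  split_ifs with hf
  · have : ∀ ε : Fin n → Bool, (∏ i, sgn (ε i)) * ∏ i, sgn (ε (f i)) = 1 := by
      intro ε
      rw [hf.prod_comp (fun i => sgn (ε i)), ← Finset.prod_mul_distrib]
      apply Finset.prod_eq_one
      intro i _
      cases ε i <;> simp [sgn]
    simp [this]
  · have hs : ¬ Function.Surjective f := fun h => hf (Finite.surjective_iff_bijective.1 h)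
    simp only [Function.Surjective, not_forall, not_exists] at hs
    obtain ⟨b, hb⟩ := hs
    apply Finset.sum_ninvolution (fun ε => Function.update ε b (!(ε b)))
    · intro ε
      have e1 : ∏ i, sgn (Function.update ε b (!(ε b)) (f i)) = ∏ i, sgn (ε (f i)) :=
        Finset.prod_congr rfl (fun i _ => by rw [Function.update_of_ne (hb i)])
      have e2 : ∏ i, sgn (Function.update ε b (!(ε b)) i) = - ∏ i, sgn (ε i) := by
        rw [← Finset.mul_prod_erase _ _ (Finset.mem_univ b),
          ← Finset.mul_prod_erase _ (fun i => sgn (ε i)) (Finset.mem_univ b)]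
        have e3 : ∏ i ∈ Finset.univ.erase b, sgn (Function.update ε b (!(ε b)) i)
            = ∏ i ∈ Finset.univ.erase b, sgn (ε i) :=
          Finset.prod_congr rfl (fun i hi => by
            rw [Function.update_of_ne (Finset.ne_of_mem_erase hi)])
        rw [e3, Function.update_self]
        cases ε b <;> simp [sgn]
      rw [e1, e2]
      ring
    · intro ε _ h
      have := congrFun h b
      simp at this
    · intro ε
      exact Finset.mem_univ _
    · intro ε
      simp

theorem grh_mixed_eq {n : ℕ} (A : Fin n → Matrix (Fin n) (Fin n) ℝ) :
    mixedDet A = (1 / (n.factorial : ℝ)) *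
      ∑ σ : Equiv.Perm (Fin n), (Matrix.of fun i j => A (σ i) i j).det := by
  have h1 : ∀ ε : Fin n → Bool, (∑ i, sgn (ε i) • A i).det =
      ∑ f : Fin n → Fin n, (∏ i, sgn (ε (f i))) * (Matrix.of fun i j => A (f i) i j).det := by
    intro ε
    have h := (Matrix.detRowAlternating (R := ℝ) (n := Fin n)).toMultilinearMap.map_sum
      (fun (i : Fin n) (k : Fin n) => (sgn (ε k) • A k) i)
    have e : (∑ i, sgn (ε i) • A i) = Matrix.of fun i => ∑ k, (sgn (ε k) • A k) i := by
      ext i j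
      simp [Matrix.sum_apply]
    rw [e]
    refine h.trans ?_
    apply Finset.sum_congr rfl
    intro f _
    have := Matrix.det_mul_column (fun i => sgn (ε (f i))) (Matrix.of fun i j => A (f i) i j)
    exact this
  unfold mixedDet
  simp_rw [h1, Finset.mul_sum]
  rw [Finset.sum_comm]
  have h2 : ∀ f : Fin n → Fin n, ∑ ε : Fin n → Bool,
      (1 / ((2 : ℝ) ^ Fintype.card (Fin n) * (Fintype.card (Fin n)).factorial)) *
      ((∏ i, sgn (ε i)) * ((∏ i, sgn (ε (f i))) * (Matrix.of fun i j => A (f i) i j).det)) =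
      if Function.Bijective f then
        (1 / (n.factorial : ℝ)) * (Matrix.of fun i j => A (f i) i j).det else 0 := by
    intro f
    simp_rw [← mul_assoc (∏ i, sgn _), ← Finset.mul_sum, ← Finset.sum_mul]
    rw [grh_sign_sum]
    have := Nat.factorial_pos n
    split_ifs
    · simp only [Fintype.card_fin]
      field_simp
    · simp
  simp_rw [h2]
  rw [← Finset.sum_filter]
  symm
  refine Finset.sum_bij (fun (σ : Equiv.Perm (Fin n)) _ => (σ : Fin n → Fin n)) ?_ ?_ ?_ ?_
  · intro σ _
    exact Finset.mem_filter.2 ⟨Finset.mem_univ _, σ.bijective⟩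
  · intro σ _ τ _ h
    exact DFunLike.coe_injective h
  · intro f hf
    exact ⟨Equiv.ofBijective f (Finset.mem_filter.1 hf).2, Finset.mem_univ _, rfl⟩
  · intro σ _
    rfl

theorem grh_conj {n : ℕ} (U : Matrix (Fin n) (Fin n) ℝ) (A : Fin n → Matrix (Fin n) (Fin n) ℝ) :
    mixedDet (fun i => U * A i * U.conjTranspose) = U.det * U.det * mixedDet A := by
  unfold mixedDet
  have : ∀ ε : Fin n → Bool, (∑ i, sgn (ε i) • (U * A i * U.conjTranspose)).det =
      U.det * U.det * (∑ i, sgn (ε i) • A i).det := by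
    intro ε
    have e : ∑ i, sgn (ε i) • (U * A i * U.conjTranspose) =
        U * (∑ i, sgn (ε i) • A i) * U.conjTranspose := by
      simp [Finset.mul_sum, Finset.sum_mul]
    rw [e, Matrix.det_mul, Matrix.det_mul, Matrix.det_conjTranspose, star_trivial]
    ring
  simp_rw [this, Finset.mul_sum]
  apply Finset.sum_congr rfl
  intro ε _
  ring

/-- The permutation sending `k` to `0` and `k.succAbove j` to `(τ j).succ`. -/
def grhPerm {n : ℕ} (k : Fin (n + 1)) (τ : Equiv.Perm (Fin n)) : Equiv.Perm (Fin (n + 1)) :=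
  ((finSuccEquiv' k).trans (Equiv.optionCongr τ)).trans (finSuccEquiv' 0).symm

theorem grhPerm_self {n : ℕ} (k : Fin (n + 1)) (τ : Equiv.Perm (Fin n)) :
    grhPerm k τ k = 0 := by
  simp [grhPerm]

theorem grhPerm_succAbove {n : ℕ} (k : Fin (n + 1)) (τ : Equiv.Perm (Fin n)) (j : Fin n) :
    grhPerm k τ (k.succAbove j) = (τ j).succ := by
  simp [grhPerm]

theorem grhPerm_bij {n : ℕ} :
    Function.Bijective (fun p : Fin (n + 1) × Equiv.Perm (Fin n) => grhPerm p.1 p.2) := by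
  rw [Fintype.bijective_iff_injective_and_card]
  constructor
  · rintro ⟨k, τ⟩ ⟨l, ρ⟩ h
    simp only at h
    have hk : k = l := by
      have h1 := grhPerm_self k τ
      have h2 := grhPerm_self l ρ
      rw [← h] at h2
      exact (grhPerm k τ).injective (h1.trans h2.symm)
    subst hk
    congr 1
    ext j
    have := congrArg (fun σ => σ (k.succAbove j)) h
    simp only [grhPerm_succAbove] at this
    exact congrArg Fin.val (Fin.succ_injective _ this)
  · simp [Fintype.card_perm, Nat.factorial_succ]

theorem grh_rec {n : ℕ} (A : Fin (n + 1) → Matrix (Fin (n + 1)) (Fin (n + 1)) ℝ)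
    (d : Fin (n + 1) → ℝ) (h0 : A 0 = Matrix.diagonal d) :
    mixedDet A = (1 / ((n + 1 : ℕ) : ℝ)) * ∑ k : Fin (n + 1), d k *
      mixedDet (fun i : Fin n => (A i.succ).submatrix k.succAbove k.succAbove) := by
  have h1 : ∀ (k : Fin (n + 1)) (τ : Equiv.Perm (Fin n)),
      (Matrix.of fun i j => A (grhPerm k τ i) i j).det =
      d k * (Matrix.of fun i j =>
        (A (τ i).succ).submatrix k.succAbove k.succAbove i j).det := by
    intro k τ
    rw [Matrix.det_succ_row _ k, Finset.sum_eq_single k]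
    · rw [← two_mul, pow_mul]
      simp only [even_two, Even.neg_pow, one_pow, one_mul, Matrix.of_apply, grhPerm_self, h0,
        Matrix.diagonal_apply_eq]
      congr 2
      ext i j
      simp [grhPerm_succAbove]
    · intro j _ hj
      simp [grhPerm_self, h0, Matrix.diagonal_apply_ne _ hj.symm]
    · simp
  simp_rw [grh_mixed_eq]
  rw [← grhPerm_bij.sum_comp (fun σ => (Matrix.of fun i j => A (σ i) i j).det),
    Fintype.sum_prod_type]
  simp_rw [h1, Finset.mul_sum]
  apply Finset.sum_congr rfl
  intro k _
  apply Finset.sum_congr rfl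
  intro τ _
  rw [Nat.factorial_succ]
  push_cast
  have : (n.factorial : ℝ) ≠ 0 := by positivity
  field_simp

theorem grh_rpow_cancel {n : ℕ} (x : Fin n → ℝ) (hx : ∀ i, 0 ≤ x i) :
    (∏ i, x i ^ n) ^ ((1 : ℝ) / n) = ∏ i, x i := by
  rcases Nat.eq_zero_or_pos n with rfl | hn
  · simp
  · rw [Finset.prod_pow, one_div, Real.pow_rpow_inv_natCast (Finset.prod_nonneg fun i _ => hx i)
      hn.ne']

theorem grh_main : ∀ (n : ℕ) (A : Fin n → Matrix (Fin n) (Fin n) ℝ)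
    (_ : ∀ j, (A j).PosSemidef), (∏ j, (A j).det) ^ ((1 : ℝ) / n) ≤ mixedDet A := by
  intro n
  induction n with
  | zero =>
    intro A hA
    simp [mixedDet]
  | succ n ih =>
    intro A hA
    -- the diagonal case
    have key : ∀ (A : Fin (n + 1) → Matrix (Fin (n + 1)) (Fin (n + 1)) ℝ)
        (_ : ∀ j, (A j).PosSemidef) (d : Fin (n + 1) → ℝ) (_ : ∀ k, 0 ≤ d k)
        (_ : A 0 = Matrix.diagonal d),
        (∏ j, (A j).det) ^ ((1 : ℝ) / ((n + 1 : ℕ) : ℝ)) ≤ mixedDet A := by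
      intro A hA d hd h0
      rw [grh_rec A d h0]
      have hsub : ∀ (k : Fin (n + 1)) (i : Fin n),
          ((A i.succ).submatrix k.succAbove k.succAbove).PosSemidef :=
        fun k i => (hA i.succ).submatrix _
      set z : Fin (n + 1) → ℝ := fun k => d k *
        (∏ i : Fin n, ((A i.succ).submatrix k.succAbove k.succAbove).det) ^ ((1 : ℝ) / n) with hz
      have hp : ∀ k : Fin (n + 1),
          0 ≤ ∏ i : Fin n, ((A i.succ).submatrix k.succAbove k.succAbove).det :=
        fun k => Finset.prod_nonneg fun i _ => (hsub k i).det_nonneg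
      have hz0 : ∀ k, 0 ≤ z k := fun k => mul_nonneg (hd k) (Real.rpow_nonneg (hp k) _)
      have hle : (1 / ((n + 1 : ℕ) : ℝ)) * ∑ k, z k ≤ (1 / ((n + 1 : ℕ) : ℝ)) *
          ∑ k : Fin (n + 1), d k *
          mixedDet (fun i : Fin n => (A i.succ).submatrix k.succAbove k.succAbove) := by
        apply mul_le_mul_of_nonneg_left _ (by positivity)
        apply Finset.sum_le_sum
        intro k _
        exact mul_le_mul_of_nonneg_left (ih _ (hsub k)) (hd k)
      refine le_trans ?_ hle
      refine le_trans ?_ (grh_amgm z hz0)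
      apply Real.rpow_le_rpow (Finset.prod_nonneg fun j _ => (hA j).det_nonneg) _ (by positivity)
      by_cases hall : ∀ j, (A j).det ≠ 0
      · have hpd : ∀ j, (A j).PosDef := fun j => (hA j).posDef_iff_det_ne_zero.2 (hall j)
        rw [Fin.prod_univ_succ, h0, Matrix.det_diagonal]
        simp only [hz]
        rw [Finset.prod_mul_distrib, Real.finsetProd_rpow _ _ (fun k _ => hp k),
          Finset.prod_comm]
        apply mul_le_mul_of_nonneg_left _ (Finset.prod_nonneg fun k _ => hd k)
        rw [← grh_rpow_cancel (fun i : Fin n => (A i.succ).det)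
          (fun i => (hA i.succ).det_nonneg)]
        apply Real.rpow_le_rpow
          (Finset.prod_nonneg fun i _ => pow_nonneg (hA i.succ).det_nonneg _) _ (by positivity)
        apply Finset.prod_le_prod (fun i _ => pow_nonneg (hA i.succ).det_nonneg _)
        intro i _
        exact grh_minors _ (hpd i.succ)
      · push Not at hall
        obtain ⟨j, hj⟩ := hall
        rw [Finset.prod_eq_zero (Finset.mem_univ j) hj]
        exact Finset.prod_nonneg fun k _ => hz0 k
    -- reduction to the diagonal case
    obtain ⟨U, hU⟩ : ∃ U : Matrix (Fin (n + 1)) (Fin (n + 1)) ℝ, U =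
      ((hA 0).1.eigenvectorUnitary : Matrix (Fin (n + 1)) (Fin (n + 1)) ℝ).conjTranspose := ⟨_, rfl⟩
    have hUU : U * U.conjTranspose = 1 := by
      rw [hU, Matrix.conjTranspose_conjTranspose]
      exact Unitary.coe_star_mul_self (hA 0).1.eigenvectorUnitary
    have hdetU : U.det * U.det = 1 := by
      have := congrArg Matrix.det hUU
      rwa [Matrix.det_mul, Matrix.det_conjTranspose, star_trivial, Matrix.det_one] at this
    have h0 : U * A 0 * U.conjTranspose = Matrix.diagonal (hA 0).1.eigenvalues := by
      have hs := (hA 0).1.spectral_theorem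
      rw [Unitary.conjStarAlgAut_apply] at hs
      have hs' : A 0 = U.conjTranspose * Matrix.diagonal (hA 0).1.eigenvalues * U := by
        rw [hU, Matrix.conjTranspose_conjTranspose]
        exact hs
      calc U * A 0 * U.conjTranspose
          = U * (U.conjTranspose * Matrix.diagonal (hA 0).1.eigenvalues * U) *
            U.conjTranspose := by rw [← hs']
        _ = (U * U.conjTranspose) * Matrix.diagonal (hA 0).1.eigenvalues *
            (U * U.conjTranspose) := by simp only [Matrix.mul_assoc]
        _ = _ := by rw [hUU, Matrix.one_mul, Matrix.mul_one]
    have hfin := key (fun i => U * A i * U.conjTranspose)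
      (fun j => (hA j).mul_mul_conjTranspose_same U) _ (fun k => (hA 0).eigenvalues_nonneg k) h0
    rw [grh_conj, hdetU, one_mul] at hfin
    have hd : ∀ j, (U * A j * U.conjTranspose).det = (A j).det := by
      intro j
      rw [Matrix.det_mul, Matrix.det_mul, Matrix.det_conjTranspose, star_trivial]
      linear_combination (A j).det * hdetU
    simp_rw [hd] at hfin
    exact hfin

/-- Gårding's reverse Hölder inequality for the determinant on `Sym_n^+`. -/
theorem garding_reverse_holder (n : ℕ) (A : Fin n → Matrix (Fin n) (Fin n) ℝ)
    (hA : ∀ j, (A j).PosSemidef) :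
    (∏ j, (A j).det) ^ ((1 : ℝ) / n) ≤ mixedDet A := by
  exact grh_main n A hA
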